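/- For every n ≥ 1 there exists a partition of {0,1}^n into exactly 2^{n−⌊log₂(n+1)⌋} nonempty blocks such that every block B satisfies |B| ≤ 2n and contains two vertices u, v that are adjacent in the hypercube Q_n and such that every vertex of B ∖ {u,v} is adjacent in Q_n to u or to v. -/

import Mathlib

/-- Adjacency in the hypercube `Q_n`: two vertices of `{0,1}^n` are adjacent iff their
Hamming distance is exactly `1`. -/
def hammingAdj {n : ℕ} (u v : Fin n → Bool) : Prop :=
  (Finset.univ.filter (fun i => u i ≠ v i)).card = 1

/-- Flip the `j`-th coordinate of a vertex. -/
def flipAt {n : ℕ} (j : Fin n) (w : Fin n → Bool) : Fin n → Bool :=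
  Function.update w j (!w j)

theorem flipAt_flipAt {n : ℕ} (j : Fin n) (w : Fin n → Bool) : flipAt j (flipAt j w) = w := by
  simp [flipAt]

theorem hammingAdj_flipAt {n : ℕ} (j : Fin n) (w : Fin n → Bool) : hammingAdj (flipAt j w) w := by
  have h : (Finset.univ.filter fun i => flipAt j w i ≠ w i) = {j} := by
    ext i
    rw [Finset.mem_filter, Finset.mem_singleton]
    by_cases hi : i = j
    · subst hi; simp [flipAt]
    · simp [flipAt, hi]
  rw [hammingAdj, h, Finset.card_singleton]

theorem hammingAdj.symm {n : ℕ} {u v : Fin n → Bool} (h : hammingAdj u v) : hammingAdj v u := by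
  simpa only [hammingAdj, ne_comm] using h

/-- The sum of the columns `col j` over the support of `w`. -/
def syndrome {n : ℕ} {S : Type*} [AddCommMonoid S] (col : Fin n → S) (w : Fin n → Bool) : S :=
  ∑ j, if w j then col j else 0

theorem syndrome_flipAt {n : ℕ} {S : Type*} [AddCommGroup S] (hS : ∀ s : S, s + s = 0)
    (col : Fin n → S) (j : Fin n) (w : Fin n → Bool) :
    syndrome col (flipAt j w) = syndrome col w + col j := by
  unfold syndrome
  rw [← Finset.add_sum_erase _ _ (Finset.mem_univ j),
    ← Finset.add_sum_erase (a := j) _ (fun i => if w i then col i else 0) (Finset.mem_univ j)]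
  have h : ∀ i ∈ Finset.univ.erase j,
      (if flipAt j w i then col i else 0) = if w i then col i else 0 := by
    intro i hi
    simp [flipAt, Finset.ne_of_mem_erase hi]
  rw [Finset.sum_congr rfl h]
  cases hw : w j
  · simp [flipAt, hw, add_comm]
  · simp only [flipAt, hw, Function.update_self, Bool.not_true, Bool.false_eq_true,
      if_false, if_true]
    rw [add_right_comm, hS]

/-- If `S` has at most `n + 1` elements, its nonzero elements are all values of some
`col : Fin n → S`. -/
theorem exists_columns {n : ℕ} {S : Type*} [AddCommGroup S] [Fintype S] [Nontrivial S]
    (h : Fintype.card S ≤ n + 1) : ∃ col : Fin n → S, ∀ s, s ≠ 0 → ∃ j, col j = s := by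
  classical
  have hc : Fintype.card {s : S // s ≠ 0} ≤ Fintype.card (Fin n) := by
    rw [Fintype.card_subtype_compl, Fintype.card_subtype_eq, Fintype.card_fin]
    omega
  obtain ⟨e⟩ := Function.Embedding.nonempty_of_card_le hc
  obtain ⟨a, ha⟩ := exists_ne (0 : S)
  have : Nonempty {s : S // s ≠ 0} := ⟨⟨a, ha⟩⟩
  exact ⟨fun j => (Function.invFun e j).1, fun s hs =>
    ⟨e ⟨s, hs⟩, by beta_reduce; rw [Function.leftInverse_invFun e.injective]⟩⟩

/-- A finite elementary abelian `2`-group `S` of order at most `n + 1` gives a partition of the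
hypercube into stars with `|S|` vertices, indexed by the vertices of syndrome zero. -/
theorem exists_star_partition {n : ℕ} (S : Type*) [AddCommGroup S] [Fintype S] [Nontrivial S]
    (hS : ∀ s : S, s + s = 0) (h : Fintype.card S ≤ n + 1) :
    ∃ P : Finset (Finset (Fin n → Bool)),
      P.card * Fintype.card S = 2 ^ n ∧
      (∀ B ∈ P, ∀ C ∈ P, B ≠ C → Disjoint B C) ∧
      (∀ v : Fin n → Bool, ∃ B ∈ P, v ∈ B) ∧
      (∀ B ∈ P, B.card ≤ Fintype.card S ∧
        ∃ u ∈ B, ∃ v ∈ B, hammingAdj u v ∧ ∀ w ∈ B, w ≠ u → hammingAdj w u) := by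
  classical
  obtain ⟨col, hcol⟩ := exists_columns (n := n) h
  obtain ⟨a, ha⟩ := exists_ne (0 : S)
  have : Nonempty (Fin n) := ⟨(hcol a ha).choose⟩
  choose! g hg using hcol
  set H := syndrome col
  let T : S → (Fin n → Bool) → (Fin n → Bool) := fun s w => if s = 0 then w else flipAt (g s) w
  have hTT : ∀ s w, T s (T s w) = w := by
    intro s w
    by_cases hs : s = 0 <;> simp [T, hs, flipAt_flipAt]
  have hHT : ∀ s w, H (T s w) = H w + s := by
    intro s w
    by_cases hs : s = 0
    · simp [T, hs]
    · simp [T, hs, H, syndrome_flipAt hS, hg]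
  have hT0 : ∀ w, T 0 w = w := fun w => by simp [T]
  let block : (Fin n → Bool) → Finset (Fin n → Bool) := fun c => Finset.univ.image fun s => T s c
  have mem_block : ∀ c, H c = 0 → ∀ w, w ∈ block c ↔ T (H w) w = c := by
    intro c hc w
    simp only [block, Finset.mem_image, Finset.mem_univ, true_and]
    constructor
    · rintro ⟨s, rfl⟩
      rw [hHT, hc, zero_add, hTT]
    · rintro rfl
      exact ⟨H w, hTT _ _⟩
  have self_mem : ∀ c, c ∈ block c := fun c =>
    Finset.mem_image.2 ⟨0, Finset.mem_univ _, hT0 c⟩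
  let Z : Finset (Fin n → Bool) := Finset.univ.filter fun c => H c = 0
  have mem_Z : ∀ c, c ∈ Z ↔ H c = 0 := fun c => by simp [Z]
  have block_inj : Set.InjOn block Z := by
    intro c hc d hd hcd
    have hc0 := (mem_Z c).1 hc
    have hmem := (mem_block d ((mem_Z d).1 hd) c).1 (hcd ▸ self_mem c)
    rwa [hc0, hT0] at hmem
  have card_Z : Z.card * Fintype.card S = 2 ^ n := by
    have e : (Fin n → Bool) ≃ Z × S :=
      { toFun := fun w => (⟨T (H w) w, (mem_Z _).2 (by rw [hHT, hS])⟩, H w)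
        invFun := fun p => T p.2 p.1
        left_inv := fun w => hTT _ _
        right_inv := by
          rintro ⟨⟨c, hc⟩, s⟩
          have hs : H (T s c) = s := by rw [hHT, (mem_Z c).1 hc, zero_add]
          simp only [hs, hTT] }
    have := Fintype.card_congr e
    simpa using this.symm
  refine ⟨Z.image block, ?_, ?_, ?_, ?_⟩
  · rw [Finset.card_image_of_injOn block_inj, card_Z]
  · simp only [Finset.forall_mem_image]
    intro c hc d hd hne
    rw [Finset.disjoint_left]
    intro w hw hw'
    rw [mem_block _ ((mem_Z _).1 hc)] at hw
    rw [mem_block _ ((mem_Z _).1 hd)] at hw'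
    exact hne (by rw [← hw, hw'])
  · intro v
    have hv : H (T (H v) v) = 0 := by rw [hHT, hS]
    exact ⟨_, Finset.mem_image_of_mem _ ((mem_Z _).2 hv), (mem_block _ hv v).2 rfl⟩
  · simp only [Finset.forall_mem_image]
    intro c hc
    have adj : ∀ s, s ≠ 0 → hammingAdj (T s c) c := by
      intro s hs
      simp only [T, hs, if_false]
      exact hammingAdj_flipAt _ _
    refine ⟨Finset.card_image_le, c, self_mem c, T a c,
      Finset.mem_image_of_mem _ (Finset.mem_univ _), (adj a ha).symm, ?_⟩
    simp only [block, Finset.forall_mem_image]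
    intro s _ hs
    exact adj s fun h0 => hs (by rw [h0, hT0])

/-- For every `n ≥ 1` there is a partition of `{0,1}^n` into exactly
`2^{n - ⌊log₂(n+1)⌋}` nonempty blocks such that every block `B` has `|B| ≤ 2n` and
contains two adjacent vertices `u, v` with every other vertex of `B` adjacent to `u`
or to `v`. -/
theorem hypercube_partition (n : ℕ) (hn : 1 ≤ n) :
    ∃ P : Finset (Finset (Fin n → Bool)),
      P.card = 2 ^ (n - Nat.log 2 (n + 1)) ∧
      (∀ B ∈ P, B.Nonempty) ∧
      (∀ B ∈ P, ∀ C ∈ P, B ≠ C → Disjoint B C) ∧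
      (∀ v : Fin n → Bool, ∃ B ∈ P, v ∈ B) ∧
      (∀ B ∈ P, B.card ≤ 2 * n ∧
        ∃ u ∈ B, ∃ v ∈ B, hammingAdj u v ∧
          ∀ w ∈ B, w ≠ u → w ≠ v → (hammingAdj w u ∨ hammingAdj w v)) := by
  have hle : 2 ^ Nat.log 2 (n + 1) ≤ n + 1 := Nat.pow_log_le_self 2 (by omega)
  have hpos : 0 < Nat.log 2 (n + 1) := Nat.log_pos (by norm_num) (by omega)
  have hlog : Nat.log 2 (n + 1) ≤ n := Nat.lt_succ_iff.1 (Nat.log_lt_self 2 (by omega))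
  have : Nonempty (Fin (Nat.log 2 (n + 1))) := ⟨⟨0, hpos⟩⟩
  have hcard : Fintype.card (Fin (Nat.log 2 (n + 1)) → ZMod 2) = 2 ^ Nat.log 2 (n + 1) := by
    simp [ZMod.card]
  obtain ⟨P, hP, hdisj, hcover, hstar⟩ :=
    exists_star_partition (n := n) (Fin (Nat.log 2 (n + 1)) → ZMod 2)
      (fun s => funext fun i => CharTwo.add_self_eq_zero (s i)) (hcard ▸ hle)
  rw [hcard] at hP hstar
  refine ⟨P, ?_, ?_, hdisj, hcover, ?_⟩
  · apply Nat.eq_of_mul_eq_mul_right (Nat.two_pow_pos (Nat.log 2 (n + 1)))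
    rw [hP, ← pow_add, Nat.sub_add_cancel hlog]
  · intro B hB
    obtain ⟨-, u, hu, -⟩ := hstar B hB
    exact ⟨u, hu⟩
  · intro B hB
    obtain ⟨hBcard, u, hu, v, hv, huv, hw⟩ := hstar B hB
    exact ⟨by omega, u, hu, v, hv, huv, fun w hwB hwu _ => Or.inl (hw w hwB hwu)⟩
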